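/- Let (Ω, 𝓕, ℙ) be a probability space and let Ŷ, Y, S : Ω → {0, 1} be measurable random variables with ℙ(S = 0) > 0 and ℙ(S = 1) > 0. Assume ℙ(Ŷ = Y) = 1 and that Y and S are not independent. Then the Demographic Parity Violation DPV := |ℙ(Ŷ = 1 ∣ S = 0) − ℙ(Ŷ = 1 ∣ S = 1)| is strictly positive. -/

import Mathlib

open MeasureTheory ProbabilityTheory

/-- Conditional probability `ℙ(A ∣ B) = ℙ(A ∩ B) / ℙ(B)`, as a real number. -/
noncomputable def condProb {Ω : Type*} [MeasureSpace Ω] (A B : Set Ω) : ℝ :=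
  ((volume : Measure Ω) (A ∩ B) / (volume : Measure Ω) B).toReal

/-- Two Boolean random variables are independent as soon as the events that they are `true` are. -/
lemma IndepSet.indepFun_bool {Ω : Type*} {mΩ : MeasurableSpace Ω} {μ : Measure Ω} {X Z : Ω → Bool}
    (h : IndepSet (X ⁻¹' {true}) (Z ⁻¹' {true}) μ) : IndepFun X Z μ := by
  have comap_le (W : Ω → Bool) : MeasurableSpace.comap W inferInstance ≤
      MeasurableSpace.generateFrom {W ⁻¹' {true}} := by
    refine Measurable.comap_le ?_
    exact @measurable_to_bool _ (MeasurableSpace.generateFrom {W ⁻¹' {true}}) W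
      (MeasurableSpace.measurableSet_generateFrom rfl)
  rw [IndepFun_iff_Indep]
  exact indep_of_indep_of_le_left (indep_of_indep_of_le_right ((IndepSet_iff_Indep _ _ _).1 h)
    (comap_le Z)) (comap_le X)

/-- An event with the same conditional probability given `B` and given `Bᶜ` is independent
of `B`. -/
lemma indepSet_of_condProb_eq {Ω : Type*} [MeasureSpace Ω]
    [IsProbabilityMeasure (volume : Measure Ω)] {A B : Set Ω}
    (hA : MeasurableSet A) (hB : MeasurableSet B)
    (hB0 : (volume : Measure Ω) B ≠ 0) (hBc0 : (volume : Measure Ω) Bᶜ ≠ 0)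
    (h : condProb A Bᶜ = condProb A B) : IndepSet A B (volume : Measure Ω) := by
  rw [indepSet_iff_measure_inter_eq_mul hA hB volume,
    ← ENNReal.toReal_eq_toReal_iff' (measure_ne_top _ _) (by finiteness), ENNReal.toReal_mul]
  have hpos : 0 < (volume : Measure Ω).real B := ENNReal.toReal_pos hB0 (measure_ne_top _ _)
  have hcpos : 0 < (volume : Measure Ω).real Bᶜ := ENNReal.toReal_pos hBc0 (measure_ne_top _ _)
  have hadd := measureReal_inter_add_sdiff (μ := (volume : Measure Ω)) (s := A) hB
  have hcompl := probReal_add_probReal_compl (μ := (volume : Measure Ω)) hB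
  simp only [condProb, ENNReal.toReal_div, ← measureReal_def] at h ⊢
  rw [div_eq_div_iff hcpos.ne' hpos.ne', ← Set.sdiff_eq] at h
  linear_combination -h - (volume : Measure Ω).real (A ∩ B) * hcompl +
    (volume : Measure Ω).real B * hadd

theorem stmt14 {Ω : Type*} [MeasureSpace Ω]
    [IsProbabilityMeasure (volume : Measure Ω)]
    (Yhat Y S : Ω → Bool)
    (hYhat : Measurable Yhat) (hY : Measurable Y) (hS : Measurable S)
    (hS0 : 0 < (volume : Measure Ω) {ω | S ω = false})
    (hS1 : 0 < (volume : Measure Ω) {ω | S ω = true})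
    (hacc : (volume : Measure Ω) {ω | Yhat ω = Y ω} = 1)
    (hdep : ¬ IndepFun Y S (volume : Measure Ω)) :
    0 < |condProb {ω | Yhat ω = true} {ω | S ω = false} -
          condProb {ω | Yhat ω = true} {ω | S ω = true}| := by
  have hae : Yhat =ᵐ[(volume : Measure Ω)] Y :=
    (prob_compl_eq_zero_iff (measurableSet_eq_fun hYhat hY)).2 hacc
  have hcond (B : Set Ω) :
      condProb {ω | Yhat ω = true} B = condProb (Y ⁻¹' {true}) B := by
    have : ({ω | Yhat ω = true} ∩ B : Set Ω) =ᵐ[(volume : Measure Ω)] (Y ⁻¹' {true} ∩ B : Set Ω) :=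
      (hae.preimage {true}).inter (Filter.EventuallyEq.refl _ B)
    rw [condProb, condProb, measure_congr this]
  have hfalse : {ω | S ω = false} = (S ⁻¹' {true})ᶜ := by ext; simp
  rw [abs_pos, sub_ne_zero, hcond, hcond]
  rw [hfalse] at hS0 ⊢
  exact fun h ↦ hdep <| IndepSet.indepFun_bool <| indepSet_of_condProb_eq
    (hY (measurableSet_singleton _)) (hS (measurableSet_singleton _)) hS1.ne' hS0.ne' h
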